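/- There exist a translation-invariant σ-algebra S(ℝ) of subsets of ℝ containing all Lebesgue measurable sets, a family (X_t)_{t∈[0,1]} of pairwise disjoint members of S(ℝ), and a family (μ_t)_{t∈[0,1]} of measures on S(ℝ) such that: (1) for every t ∈ [0,1], μ_t is translation-invariant and agrees with the linear Lebesgue measure λ on all Lebesgue measurable sets; (2) μ_t(ℝ \ X_t) = 0 for every t ∈ [0,1]; in particular, for all t ≠ t' the measures μ_t and μ_{t'} are orthogonal, i.e., there exists X ∈ S(ℝ) with μ_t(X) = 0 and μ_{t'}(ℝ \ X) = 0. -/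

import Mathlib

open MeasureTheory

/-- A subset of `ℝ` is Lebesgue measurable iff it is null-measurable with respect to
the (Borel) Lebesgue measure. -/
def IsLebesgueMeasurable (A : Set ℝ) : Prop :=
  NullMeasurableSet A volume

section

open Cardinal Set

theorem mk_iUnion_lt_continuum {α : Type} {f : ℕ → Set α} (h : ∀ n, #(f n) < 𝔠) :
    #(⋃ n, f n : Set α) < 𝔠 := by
  refine (mk_iUnion_le f).trans_lt (mul_lt_of_lt aleph0_le_continuum ?_ ?_)
  · simpa using aleph0_lt_continuum
  · refine iSup_lt_of_lt_cof_ord ?_ h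
    rw [mk_nat, ← two_power_aleph0]
    exact lt_cof_ord_power le_rfl one_lt_two

theorem mk_union_lt_continuum {α : Type} {s t : Set α} (hs : #s < 𝔠) (ht : #t < 𝔠) :
    #(s ∪ t : Set α) < 𝔠 :=
  (mk_union_le s t).trans_lt (add_lt_of_lt aleph0_le_continuum hs ht)

theorem mk_lt_of_subset {α : Type} {s t : Set α} {c : Cardinal} (h : s ⊆ t) (ht : #t < c) :
    #s < c :=
  (mk_le_mk_of_subset h).trans_lt ht

theorem MeasurableSet.continuum_le_mk {B : Set ℝ} (hB : MeasurableSet B) (h : ¬ B.Countable) :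
    𝔠 ≤ #B := by
  have := hB.standardBorel
  have e : B ≃ ℝ := (PolishSpace.measurableEquivOfNotCountable (fun hc => h hc)
    (by simp)).toEquiv
  rw [mk_congr e, mk_real]

theorem exists_strictSeq {ι : Type} [LinearOrder ι] [WellFoundedLT ι]
    (hι : ∀ i : ι, #(Iio i) < 𝔠) (y : ι → ℝ) (F : ι → Set ℝ) (hF : ∀ i, 𝔠 ≤ #(F i)) :
    ∃ e : ι → ℝ, ∀ i, e i ∈ F i ∧ e i ∉ Subfield.closure (e '' Iio i ∪ y '' Iio i) := by
  have key (i : ι) (s : Set ℝ) (hs : #s < 𝔠) :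
      ∃ x, x ∈ F i ∧ x ∉ Subfield.closure (s ∪ y '' Iio i) := by
    by_contra! hcon
    refine (((hF i).trans (mk_le_mk_of_subset hcon)).trans
      (Subfield.cardinalMk_closure_le_max _)).not_gt (max_lt ?_ aleph0_lt_continuum)
    exact mk_union_lt_continuum hs (mk_image_le.trans_lt (hι i))
  have hr (i : ι) (g : ∀ j, j < i → ℝ) : #(range fun j : Iio i => g j.1 j.2) < 𝔠 :=
    mk_range_le.trans_lt (hι i)
  let e : ι → ℝ := wellFounded_lt.fix fun i g => (key i _ (hr i g)).choose
  refine ⟨e, fun i => ?_⟩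
  have he : e i = (key i _ (hr i fun j _ => e j)).choose := wellFounded_lt.fix_eq _ i
  have := (key i _ (hr i fun j _ => e j)).choose_spec
  rw [← he] at this
  rwa [image_eq_range e]

/-- There is a disjoint family of sets, indexed by any type of size at most the continuum, each of
which is invariant under translations up to fewer than continuum many points and meets every
uncountable Borel set in continuum many points. -/
theorem exists_disjoint_almostInvariant_family (T : Type) [Nonempty T] (hT : #T ≤ 𝔠) :
    ∃ X : T → Set ℝ, (∀ t t', t ≠ t' → X t ∩ X t' = ∅) ∧
      (∀ t (g : ℝ), #{x | x ∈ X t ∧ g + x ∉ X t} < 𝔠) ∧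
      (∀ t (B : Set ℝ), MeasurableSet B → ¬ B.Countable → 𝔠 ≤ #(B ∩ X t : Set ℝ)) := by
  let ι := (𝔠 : Cardinal.{0}).ord.ToType
  have hι : #ι = 𝔠 := mk_ord_toType _
  have hIio (i : ι) : #(Iio i) < 𝔠 := by
    simpa only [hι] using mk_Iio_lt i (by simp [ι])
  have hIic (i : ι) : #(Iic i) < 𝔠 := by
    rw [← Iio_union_right]
    exact mk_union_lt_continuum (hIio i) (by simpa using one_lt_aleph0.trans aleph0_lt_continuum)
  obtain ⟨y⟩ : Nonempty (ι ≃ ℝ) := Cardinal.eq.1 (hι.trans mk_real.symm)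
  let 𝓑 := {B : Set ℝ // MeasurableSet B ∧ ¬ B.Countable}
  have : Nonempty 𝓑 := ⟨⟨univ, MeasurableSet.univ, not_countable_univ⟩⟩
  have h𝓑 : #𝓑 ≤ 𝔠 :=
    (mk_le_mk_of_subset (s := {B : Set ℝ | MeasurableSet B ∧ ¬ B.Countable})
      (t := {B : Set ℝ | MeasurableSet B}) fun _ h => h.1).trans (by
      obtain ⟨b, hb, hgen⟩ := MeasurableSpace.CountablyGenerated.isCountablyGenerated (α := ℝ)
      rw [hgen]
      exact MeasurableSpace.cardinal_measurableSet_le_continuum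
        (hb.le_aleph0.trans aleph0_le_continuum))
  obtain ⟨φ⟩ : Nonempty (𝓑 × T × ℝ ↪ ι) := by
    rw [← Cardinal.le_def, hι]
    simp only [mk_prod, lift_id, mk_real]
    calc #𝓑 * (#T * 𝔠) ≤ 𝔠 * (𝔠 * 𝔠) := by gcongr
      _ = 𝔠 := by simp
  let p := Function.invFun φ
  have hp (q) : p (φ q) = q := Function.leftInverse_invFun φ.injective q
  obtain ⟨e, he⟩ := exists_strictSeq hIio y (fun i => (p i).1.1)
    fun i => (p i).1.2.1.continuum_le_mk (p i).1.2.2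
  let K (i : ι) : Subfield ℝ := Subfield.closure (e '' Iic i ∪ y '' Iic i)
  have hK (i : ι) : #(K i) < 𝔠 :=
    (Subfield.cardinalMk_closure_le_max _).trans_lt (max_lt (mk_union_lt_continuum
      (mk_image_le.trans_lt (hIic i)) (mk_image_le.trans_lt (hIic i))) aleph0_lt_continuum)
  have hKmono {i j : ι} (h : i ≤ j) : K i ≤ K j :=
    Subfield.closure_mono (union_subset_union (image_mono (Iic_subset_Iic.2 h))
      (image_mono (Iic_subset_Iic.2 h)))
  have hne (x : ℝ) : {i | x ∈ K i}.Nonempty :=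
    ⟨y.symm x, Subfield.subset_closure (Or.inr ⟨y.symm x, self_mem_Iic, by simp⟩)⟩
  let r (x : ℝ) : ι := wellFounded_lt.min {i | x ∈ K i} (hne x)
  have hr {x : ℝ} {i : ι} : r x ≤ i ↔ x ∈ K i :=
    ⟨fun h => hKmono h (wellFounded_lt.min_mem _ (hne x)),
      fun h => not_lt.1 (wellFounded_lt.not_lt_min {i | x ∈ K i} h)⟩
  have hre (i : ι) : r (e i) = i := by
    refine le_antisymm (hr.2 (Subfield.subset_closure (Or.inl ⟨i, self_mem_Iic, rfl⟩))) ?_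
    by_contra! hlt
    exact (he i).2 (Subfield.closure_mono (union_subset_union
      (image_mono (Iic_subset_Iio.2 hlt)) (image_mono (Iic_subset_Iio.2 hlt))) (hr.1 le_rfl))
  have hradd (g x : ℝ) (h : r g < r x) : r (g + x) = r x := by
    refine le_antisymm (hr.2 (add_mem (hr.1 h.le) (hr.1 le_rfl))) ?_
    by_contra! hlt
    have : x ∈ K (max (r g) (r (g + x))) := by
      have := sub_mem (hr.1 (le_max_right (r g) (r (g + x)))) (hr.1 (le_max_left (r g) (r (g + x))))
      simpa using this
    exact (hr.2 this).not_gt (max_lt h hlt)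
  refine ⟨fun t => {x | (p (r x)).2.1 = t}, fun t t' h => ?_, fun t g => ?_, fun t B hB hc => ?_⟩
  · ext x
    simp only [mem_inter_iff, mem_ofPred_eq, mem_empty_iff_false, iff_false, not_and]
    exact fun h1 h2 => h (h1.symm.trans h2)
  · refine mk_lt_of_subset (t := (K (r g) : Set ℝ)) (fun x hx => ?_) (hK (r g))
    refine hr.1 (not_lt.1 fun hlt => hx.2 ?_)
    simpa [hradd g x hlt] using hx.1
  · rw [← mk_real]
    let q (s : ℝ) : 𝓑 × T × ℝ := (⟨B, hB, hc⟩, t, s)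
    refine mk_le_of_injective (f := fun s => (⟨e (φ (q s)), ?_, ?_⟩ : (B ∩ _ : Set ℝ)))
      fun s s' h => ?_
    · simpa [hp] using (he (φ (q s))).1
    · simp [hre, hp, q]
    · have := congrArg r (Subtype.mk.inj h)
      rw [hre, hre] at this
      simpa [q] using φ.injective this

theorem volume_eq_zero_of_mk_inter_lt {X : Set ℝ}
    (hX : ∀ B : Set ℝ, MeasurableSet B → ¬ B.Countable → 𝔠 ≤ #(B ∩ X : Set ℝ))
    {B : Set ℝ} (hB : NullMeasurableSet B volume) (h : #(B ∩ X : Set ℝ) < 𝔠) :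
    volume B = 0 := by
  obtain ⟨C, hCB, hC, hae⟩ := hB.exists_measurable_subset_ae_eq
  rw [← measure_congr hae]
  by_contra hne
  exact ((hX C hC fun hc => hne (hc.measure_zero _)).trans
    (mk_le_mk_of_subset (inter_subset_inter_left X hCB))).not_gt h

/-- `B` is a Lebesgue measurable set that coincides with `A` on `X` up to fewer than continuum many
points. -/
def ApproximatesOn (X A B : Set ℝ) : Prop :=
  NullMeasurableSet B volume ∧ #(symmDiff A B ∩ X : Set ℝ) < 𝔠

namespace ApproximatesOn

variable {X A A' B B' : Set ℝ}

theorem refl (hA : NullMeasurableSet A volume) : ApproximatesOn X A A :=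
  ⟨hA, by simpa using continuum_pos⟩

theorem compl (h : ApproximatesOn X A B) : ApproximatesOn X Aᶜ Bᶜ :=
  ⟨h.1.compl, by rw [compl_symmDiff_compl]; exact h.2⟩

theorem iUnion {A B : ℕ → Set ℝ} (h : ∀ n, ApproximatesOn X (A n) (B n)) :
    ApproximatesOn X (⋃ n, A n) (⋃ n, B n) := by
  refine ⟨.iUnion fun n => (h n).1,
    mk_lt_of_subset (fun x hx => ?_) (mk_iUnion_lt_continuum fun n => (h n).2)⟩
  simp only [mem_inter_iff, mem_symmDiff, mem_iUnion] at hx ⊢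
  grind

theorem translate (hX : ∀ g : ℝ, #{x | x ∈ X ∧ g + x ∉ X} < 𝔠) (g : ℝ)
    (h : ApproximatesOn X A B) :
    ApproximatesOn X ((fun x => g + x) '' A) ((fun x => g + x) '' B) := by
  constructor
  · rw [image_add_left]
    exact h.1.preimage (measurePreserving_add_left volume (-g)).quasiMeasurePreserving
  · refine mk_lt_of_subset (t := (fun x => g + x) '' (symmDiff A B ∩ X) ∪
      {x | x ∈ X ∧ -g + x ∉ X}) (fun x hx => ?_)
      (mk_union_lt_continuum (mk_image_le.trans_lt h.2) (hX (-g)))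
    simp only [Set.image_add_left, mem_inter_iff, mem_symmDiff, mem_preimage, mem_union,
      mem_ofPred_eq] at hx ⊢
    grind

theorem volume_inter_eq_zero
    (hX : ∀ B : Set ℝ, MeasurableSet B → ¬ B.Countable → 𝔠 ≤ #(B ∩ X : Set ℝ))
    (h : ApproximatesOn X A B) (h' : ApproximatesOn X A' B') (hd : Disjoint A A') :
    volume (B ∩ B') = 0 := by
  refine volume_eq_zero_of_mk_inter_lt hX (h.1.inter h'.1)
    (mk_lt_of_subset (fun x hx => ?_) (mk_union_lt_continuum h.2 h'.2))
  have : x ∈ A → x ∉ A' := fun h => Set.disjoint_left.1 hd h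
  simp only [mem_inter_iff, mem_union, mem_symmDiff] at hx ⊢
  tauto

theorem volume_eq
    (hX : ∀ B : Set ℝ, MeasurableSet B → ¬ B.Countable → 𝔠 ≤ #(B ∩ X : Set ℝ))
    (h : ApproximatesOn X A B) (h' : ApproximatesOn X A B') : volume B = volume B' := by
  refine measure_congr (measure_symmDiff_eq_zero_iff.1 ?_)
  refine volume_eq_zero_of_mk_inter_lt hX
    ((h.1.diff h'.1).union (h'.1.diff h.1))
    (mk_lt_of_subset (fun x hx => ?_) (mk_union_lt_continuum h.2 h'.2))
  simp only [mem_inter_iff, mem_union, mem_symmDiff] at hx ⊢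
  tauto

end ApproximatesOn

/-- The σ-algebra of the sets that can be approximated by Lebesgue measurable sets on each member
of the family `X`. -/
@[reducible]
def approximableSpace {T : Type} (X : T → Set ℝ) : MeasurableSpace ℝ where
  MeasurableSet' A := ∀ t, ∃ B, ApproximatesOn (X t) A B
  measurableSet_empty t := ⟨∅, .refl .empty⟩
  measurableSet_compl A hA t := (hA t).imp' _ fun _ h => h.compl
  measurableSet_iUnion A hA t := by
    choose B hB using fun n => hA n t
    exact ⟨_, .iUnion hB⟩

theorem exists_measure_of_approximatesOn {T : Type} {X : T → Set ℝ} {t : T}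
    (hX : ∀ B : Set ℝ, MeasurableSet B → ¬ B.Countable → 𝔠 ≤ #(B ∩ X t : Set ℝ)) :
    ∃ μ : @Measure ℝ (approximableSpace X), ∀ A B, MeasurableSet[approximableSpace X] A →
      ApproximatesOn (X t) A B → μ A = volume B := by
  refine ⟨@Measure.ofMeasurable ℝ (approximableSpace X) (fun A hA => volume (hA t).choose) ?_ ?_,
    fun A B hA hB => ?_⟩
  · have hE := (@MeasurableSet.empty ℝ (approximableSpace X)) t
    rw [hE.choose_spec.volume_eq hX (.refl .empty), measure_empty]
  · intro A hA hd
    rw [(@MeasurableSet.iUnion _ _ (approximableSpace X) _ _ hA t).choose_spec.volume_eq hX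
      (.iUnion fun n => (hA n t).choose_spec)]
    exact measure_iUnion₀
      (fun i j hij => (hA i t).choose_spec.volume_inter_eq_zero hX (hA j t).choose_spec (hd hij))
      fun n => (hA n t).choose_spec.1
  · rw [@Measure.ofMeasurable_apply _ (approximableSpace X) _ _ _ _ hA]
    exact (hA t).choose_spec.volume_eq hX hB

end

/-- there exist a translation-invariant σ-algebra `S` on `ℝ` containing
all Lebesgue measurable sets, a family `(X_t)_{t ∈ [0,1]}` of pairwise disjoint
members of `S`, and a family `(μ_t)_{t ∈ [0,1]}` of measures on `S` such that each
`μ_t` is a translation-invariant extension of the Lebesgue measure, `μ_t(ℝ \ X_t) = 0`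
for each `t`, and in particular the measures are pairwise orthogonal. -/
theorem stmt11 :
    ∃ (S : MeasurableSpace ℝ) (X : ↥(Set.Icc (0 : ℝ) 1) → Set ℝ)
      (μ : ↥(Set.Icc (0 : ℝ) 1) → @Measure ℝ S),
      (∀ A : Set ℝ, IsLebesgueMeasurable A → MeasurableSet[S] A) ∧
      (∀ (g : ℝ) (A : Set ℝ), MeasurableSet[S] A →
        MeasurableSet[S] ((fun x => g + x) '' A)) ∧
      (∀ t, MeasurableSet[S] (X t)) ∧
      (∀ t t', t ≠ t' → X t ∩ X t' = ∅) ∧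
      (∀ t (g : ℝ) (A : Set ℝ), MeasurableSet[S] A →
        μ t ((fun x => g + x) '' A) = μ t A) ∧
      (∀ t (A : Set ℝ), IsLebesgueMeasurable A → μ t A = volume A) ∧
      (∀ t, μ t (Set.univ \ X t) = 0) ∧
      (∀ t t', t ≠ t' → ∃ A : Set ℝ, MeasurableSet[S] A ∧
        μ t A = 0 ∧ μ t' (Set.univ \ A) = 0) := by
  obtain ⟨X, hd, hinv, hthick⟩ := exists_disjoint_almostInvariant_family (Set.Icc (0 : ℝ) 1)
    ((Cardinal.mk_subtype_le _).trans_eq Cardinal.mk_real)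
  choose μ hμ using fun t => exists_measure_of_approximatesOn (hthick t)
  have hself (t) : ApproximatesOn (X t) (Set.univ \ X t) ∅ :=
    ⟨.empty, by simpa [symmDiff_def] using Cardinal.continuum_pos⟩
  have hdisj (t t') (h : t ≠ t') : ApproximatesOn (X t') (X t) ∅ :=
    ⟨.empty, by simpa [symmDiff_def, hd t t' h] using Cardinal.continuum_pos⟩
  have hmeas (t) : MeasurableSet[approximableSpace X] (X t) := by
    intro t'
    by_cases h : t = t'
    · subst h
      exact ⟨_, by simpa [← Set.compl_eq_univ_sdiff] using (hself t).compl⟩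
    · exact ⟨_, hdisj t t' h⟩
  have hzero (t) : μ t (Set.univ \ X t) = 0 := by
    rw [hμ t _ ∅ _ (hself t), measure_empty]
    rw [← Set.compl_eq_univ_sdiff]
    exact (hmeas t).compl
  refine ⟨approximableSpace X, X, μ, fun A hA t => ⟨A, .refl hA⟩,
    fun g A hA t => (hA t).imp' _ fun B hB => hB.translate (hinv t) g, hmeas, hd,
    fun t g A hA => ?_, fun t A hA => hμ t A A (fun t => ⟨A, .refl hA⟩) (.refl hA), hzero,
    fun t t' h => ⟨X t', hmeas t', ?_, hzero t'⟩⟩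
  · obtain ⟨B, hB⟩ := hA t
    rw [hμ t A B hA hB, hμ t _ _ (fun t => (hA t).imp' _ fun B hB => hB.translate (hinv t) g)
      (hB.translate (hinv t) g), Set.image_add_left, measure_preimage_add]
  · rw [hμ t _ ∅ (hmeas t') (hdisj t' t h.symm), measure_empty]
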